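/- arXiv:2302.04518 — 2 statements merged into one kernel-verified Lean document; each statement's English description precedes it below -/
import Mathlib

section
/- Let (Ω, ℱ, ℙ) be a probability space, d_u, d_y ≥ 1, and Γ ∈ ℝ^{d_y×d_y} a symmetric positive definite matrix. Let u : Ω → ℝ^{d_u} be a random variable with law μ₀, and let η : Ω → ℝ^{d_y} be independent of u with law given by the density ξ ↦ (2π)^{−d_y/2} det(Γ)^{−1/2} exp(−½ ⟨ξ, Γ⁻¹ ξ⟩) with respect to Lebesgue measure on ℝ^{d_y}. Let 𝒢 : ℝ^{d_u} → ℝ^{d_y} be continuous and set y := 𝒢(u) + η. Then for (law of y)-almost every y₀ ∈ ℝ^{d_y}, the value Z(y₀) := ∫_{ℝ^{d_u}} exp(−Φ_{y₀}(v)) μ₀(dv) lies in (0, ∞) and a regular conditional distribution of u given y evaluated at y₀ equals the measure Z(y₀)^{−1} exp(−Φ_{y₀}) · μ₀, where Φ_{y₀}(v) := ½ ⟨y₀ − 𝒢(v), Γ⁻¹ (y₀ − 𝒢(v))⟩. -/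
open MeasureTheory ProbabilityTheory Matrix

/-- If `ξ` has density `g` and is independent of `X`, then `(f(X) + ξ, X)` has density
`(z, x) ↦ g (z - f x)` with respect to the product of the reference measure and the law of `X`. -/
theorem map_add_prodMk_eq_withDensity_of_indepFun {Ω E G : Type*} [MeasurableSpace Ω]
    [MeasurableSpace E] [AddCommGroup G] [MeasurableSpace G] [MeasurableAdd₂ G] [MeasurableSub₂ G]
    {P : Measure Ω} [IsProbabilityMeasure P] {ν : Measure G} [SFinite ν]
    [ν.IsAddRightInvariant] {X : Ω → E} {ξ : Ω → G} (hX : Measurable X)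
    (hξ : Measurable ξ) (hindep : IndepFun X ξ P) {g : G → ENNReal} (hg : Measurable g)
    (hlaw : P.map ξ = ν.withDensity g) {f : E → G} (hf : Measurable f) :
    P.map (fun ω => (f (X ω) + ξ ω, X ω)) =
      (ν.prod (P.map X)).withDensity fun p => g (p.1 - f p.2) := by
  have hpair : P.map (fun ω => (X ω, ξ ω)) = (P.map X).prod (P.map ξ) :=
    (indepFun_iff_map_prod_eq_prod_map_map hX.aemeasurable hξ.aemeasurable).1 hindep
  have : IsProbabilityMeasure (P.map X) := Measure.isProbabilityMeasure_map hX.aemeasurable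
  have : IsProbabilityMeasure (P.map ξ) := Measure.isProbabilityMeasure_map hξ.aemeasurable
  have hshift : P.map (fun ω => (f (X ω) + ξ ω, X ω)) =
      (P.map (fun ω => (X ω, ξ ω))).map fun p => (f p.1 + p.2, p.1) := by
    rw [Measure.map_map (by fun_prop) (by fun_prop)]
    rfl
  refine Measure.ext_of_lintegral _ fun φ hφ => ?_
  rw [hshift, lintegral_map hφ (by fun_prop), hpair, lintegral_prod _ (by fun_prop),
    lintegral_withDensity_eq_lintegral_mul _ (by fun_prop) hφ,
    lintegral_prod_symm _ (by fun_prop)]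
  refine lintegral_congr fun x => ?_
  rw [hlaw, lintegral_withDensity_eq_lintegral_mul _ hg (by fun_prop),
    ← lintegral_sub_right_eq_self _ (f x)]
  simp only [Pi.mul_apply, add_sub_cancel]

/-- A joint density `(x, v) ↦ a x * h x v` with `h x` a probability density for every `x`
identifies `h` as the conditional density. -/
theorem condDistrib_ae_eq_withDensity {Ω E F : Type*} [MeasurableSpace Ω] [MeasurableSpace E]
    [MeasurableSpace F] [StandardBorelSpace F] [Nonempty F] {P : Measure Ω}
    [IsProbabilityMeasure P] {X : Ω → E} {Y : Ω → F} (hX : Measurable X) (hY : Measurable Y)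
    {ν : Measure E} [SFinite ν] {μ : Measure F} [SFinite μ] {a : E → ENNReal}
    {h : E → F → ENNReal} (ha : Measurable a) (hh : Measurable (Function.uncurry h))
    (hone : ∀ x, ∫⁻ v, h x v ∂μ = 1)
    (hjoint : P.map (fun ω => (X ω, Y ω)) = (ν.prod μ).withDensity fun p => a p.1 * h p.1 p.2) :
    ∀ᵐ x ∂P.map X, condDistrib Y X P x = μ.withDensity (h x) := by
  have hmarg : P.map X = ν.withDensity a := by
    have hfst : P.map X = (P.map (fun ω => (X ω, Y ω))).map Prod.fst := by
      rw [Measure.map_map (by fun_prop) (by fun_prop)]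
      rfl
    refine Measure.ext_of_lintegral _ fun φ hφ => ?_
    rw [hfst, lintegral_map hφ (by fun_prop), hjoint,
      lintegral_withDensity_eq_lintegral_mul _ (by fun_prop) (by fun_prop),
      lintegral_prod _ (by fun_prop), lintegral_withDensity_eq_lintegral_mul _ ha hφ]
    refine lintegral_congr fun x => ?_
    have hx : Measurable (h x) := hh.of_uncurry_left
    simp only [Pi.mul_apply]
    rw [lintegral_mul_const _ (by fun_prop), lintegral_const_mul _ hx, hone, mul_one]
  let κ : Kernel E F := Kernel.withDensity (Kernel.const E μ) h
  have hκ : ∀ x, κ x = μ.withDensity (h x) := fun x => by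
    simp [κ, Kernel.withDensity_apply _ hh]
  have : IsMarkovKernel κ := ⟨fun x => ⟨by simp [hκ, hone]⟩⟩
  have : IsProbabilityMeasure (P.map X) := Measure.isProbabilityMeasure_map hX.aemeasurable
  have hcomp : P.map (fun ω => (X ω, Y ω)) = P.map X ⊗ₘ κ := by
    refine Measure.ext_of_lintegral _ fun φ hφ => ?_
    rw [Measure.lintegral_compProd hφ, hmarg,
      lintegral_withDensity_eq_lintegral_mul _ ha (by fun_prop), hjoint,
      lintegral_withDensity_eq_lintegral_mul _ (by fun_prop) hφ, lintegral_prod _ (by fun_prop)]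
    refine lintegral_congr fun x => ?_
    have hx : Measurable (h x) := hh.of_uncurry_left
    simp only [Pi.mul_apply, mul_assoc]
    rw [lintegral_const_mul _ (by fun_prop), hκ,
      lintegral_withDensity_eq_lintegral_mul _ hx (by fun_prop)]
    rfl
  filter_upwards [condDistrib_ae_eq_of_measure_eq_compProd X hY.aemeasurable hcomp] with x hx
  rw [hx, hκ]

/-- Bayes' theorem for the inverse problem `y = 𝒢(u) + η` with Gaussian noise
`η ∼ N(0, Γ)` independent of `u ∼ μ₀`: for (law of `y`)-almost every `y₀`, the
normalization constant `Z(y₀) = ∫ exp(−Φ_{y₀}(v)) μ₀(dv)` lies in `(0, ∞)` and the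
regular conditional distribution of `u` given `y = y₀` has density
`Z(y₀)⁻¹ exp(−Φ_{y₀})` with respect to the prior `μ₀`, where
`Φ_{y₀}(v) = ½⟨y₀ − 𝒢(v), Γ⁻¹(y₀ − 𝒢(v))⟩`. -/
theorem stmt_2 {Ω : Type*} [MeasurableSpace Ω] (P : Measure Ω) [IsProbabilityMeasure P]
    (du dy : ℕ) (hdu : 1 ≤ du) (hdy : 1 ≤ dy)
    (Γ : Matrix (Fin dy) (Fin dy) ℝ) (hΓ : Γ.PosDef)
    (u : Ω → (Fin du → ℝ)) (hu : Measurable u)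
    (η : Ω → (Fin dy → ℝ)) (hη : Measurable η)
    (hindep : IndepFun u η P)
    (hηlaw : Measure.map η P =
      volume.withDensity fun ξ => ENNReal.ofReal
        ((2 * Real.pi) ^ (-(dy : ℝ) / 2) * Γ.det ^ (-(1 : ℝ) / 2) *
          Real.exp (-(1 / 2) * (ξ ⬝ᵥ (Γ⁻¹ *ᵥ ξ)))))
    (𝒢 : (Fin du → ℝ) → (Fin dy → ℝ)) (h𝒢 : Continuous 𝒢)
    (μ₀ : Measure (Fin du → ℝ)) (hμ₀ : μ₀ = Measure.map u P)
    (y : Ω → (Fin dy → ℝ)) (hy : y = fun ω => 𝒢 (u ω) + η ω) :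
    ∀ᵐ y₀ ∂(Measure.map y P),
      Integrable
        (fun v => Real.exp (-(1 / 2) * ((y₀ - 𝒢 v) ⬝ᵥ (Γ⁻¹ *ᵥ (y₀ - 𝒢 v))))) μ₀ ∧
      0 < (∫ v, Real.exp (-(1 / 2) * ((y₀ - 𝒢 v) ⬝ᵥ (Γ⁻¹ *ᵥ (y₀ - 𝒢 v)))) ∂μ₀) ∧
      condDistrib u y P y₀ =
        μ₀.withDensity fun v => ENNReal.ofReal
          ((∫ w, Real.exp (-(1 / 2) * ((y₀ - 𝒢 w) ⬝ᵥ (Γ⁻¹ *ᵥ (y₀ - 𝒢 w)))) ∂μ₀)⁻¹ *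
            Real.exp (-(1 / 2) * ((y₀ - 𝒢 v) ⬝ᵥ (Γ⁻¹ *ᵥ (y₀ - 𝒢 v))))) := by
  have hprob : IsProbabilityMeasure μ₀ :=
    hμ₀ ▸ Measure.isProbabilityMeasure_map hu.aemeasurable
  have h𝒢m : Measurable 𝒢 := h𝒢.measurable
  have hQ : Continuous fun ξ : Fin dy → ℝ => ξ ⬝ᵥ (Γ⁻¹ *ᵥ ξ) := by fun_prop
  have hQ0 : ∀ ξ : Fin dy → ℝ, 0 ≤ ξ ⬝ᵥ (Γ⁻¹ *ᵥ ξ) := fun ξ => by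
    simpa using hΓ.inv.posSemidef.dotProduct_mulVec_nonneg ξ
  set e : (Fin dy → ℝ) → ℝ := fun ξ => Real.exp (-(1 / 2) * (ξ ⬝ᵥ (Γ⁻¹ *ᵥ ξ)))
  have hem : Measurable e := by
    have := hQ.measurable
    fun_prop
  have hepos : ∀ ξ, 0 < e ξ := fun ξ => Real.exp_pos _
  have hele : ∀ ξ, e ξ ≤ 1 := fun ξ => Real.exp_le_one_iff.2 (by linarith [hQ0 ξ])
  set c : ℝ := (2 * Real.pi) ^ (-(dy : ℝ) / 2) * Γ.det ^ (-(1 : ℝ) / 2)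
  have hc0 : 0 ≤ c := by
    have := hΓ.det_pos
    positivity
  have hint : ∀ y₀, Integrable (fun v => e (y₀ - 𝒢 v)) μ₀ := fun y₀ =>
    Integrable.of_bound (by fun_prop) 1 (.of_forall fun v => by
      simpa [abs_of_pos (hepos _)] using hele _)
  set Z : (Fin dy → ℝ) → ℝ := fun y₀ => ∫ v, e (y₀ - 𝒢 v) ∂μ₀
  have hZpos : ∀ y₀, 0 < Z y₀ := fun y₀ =>
    (integral_pos_iff_support_of_nonneg (fun v => (hepos _).le) (hint y₀)).2 <| by
      simp [Function.support_eq_univ fun v => (hepos (y₀ - 𝒢 v)).ne']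
  have hZm : Measurable Z :=
    (StronglyMeasurable.integral_prod_right' (ν := μ₀)
      (f := fun p : (Fin dy → ℝ) × (Fin du → ℝ) => e (p.1 - 𝒢 p.2))
      (by fun_prop : Measurable _).stronglyMeasurable).measurable
  have hym : Measurable y := by
    rw [hy]
    fun_prop
  have hone : ∀ y₀, ∫⁻ v, ENNReal.ofReal ((Z y₀)⁻¹ * e (y₀ - 𝒢 v)) ∂μ₀ = 1 := fun y₀ => by
    rw [← ofReal_integral_eq_lintegral_ofReal ((hint y₀).const_mul _)
      (.of_forall fun v => mul_nonneg (inv_nonneg.2 (hZpos y₀).le) (hepos _).le),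
      integral_const_mul, inv_mul_cancel₀ (hZpos y₀).ne', ENNReal.ofReal_one]
  have hjoint : P.map (fun ω => (y ω, u ω)) = (volume.prod μ₀).withDensity fun p =>
      ENNReal.ofReal (c * Z p.1) * ENNReal.ofReal ((Z p.1)⁻¹ * e (p.1 - 𝒢 p.2)) := by
    rw [hy, map_add_prodMk_eq_withDensity_of_indepFun hu hη hindep (by fun_prop) hηlaw h𝒢m, hμ₀]
    congr 1
    funext p
    rw [← ENNReal.ofReal_mul (mul_nonneg hc0 (hZpos _).le), mul_assoc c,
      mul_inv_cancel_left₀ (hZpos _).ne']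
  have hcond := condDistrib_ae_eq_withDensity hym hu
    (a := fun y₀ => ENNReal.ofReal (c * Z y₀))
    (h := fun y₀ v => ENNReal.ofReal ((Z y₀)⁻¹ * e (y₀ - 𝒢 v)))
    (by fun_prop) (by unfold Function.uncurry; fun_prop) hone hjoint
  filter_upwards [hcond] with y₀ hy₀
  exact ⟨hint y₀, hZpos y₀, hy₀⟩
end

section
/- Let (U, 𝒮) be a measurable space and μ₀ a probability measure on U, let Φ : U → ℝ be measurable with Z := ∫_U exp(−Φ) dμ₀ ∈ (0,∞), and let μ^y := Z^{-1} exp(−Φ) · μ₀. Let (p₁, p₁') be a Hölder-conjugate pair with 1 < p₁ ≤ ∞, let C₁ > 0, and let Ψ : U → ℝ be measurable with ‖exp(Φ − Ψ)‖_{L^{p₁}_{μ^y}(U)} ≤ C₁. Then Z_Ψ := ∫_U exp(−Ψ) dμ₀ is finite and the normalization constants satisfy |Z − Z_Ψ| ≤ Z · (1 + C₁) · ‖Φ − Ψ‖_{L^{2p₁'}_{μ^y}(U)}. -/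
open MeasureTheory ENNReal

theorem abs_one_sub_exp_le (x : ℝ) : |1 - Real.exp x| ≤ |x| + |x| * Real.exp x := by
  have h1 := Real.add_one_le_exp x
  have h2 : (1 - x) * Real.exp x ≤ 1 := by
    calc (1 - x) * Real.exp x ≤ Real.exp (-x) * Real.exp x := by
          gcongr
          linarith [Real.add_one_le_exp (-x)]
      _ = 1 := by rw [← Real.exp_add]; simp
  have hpos := Real.exp_pos x
  rcases le_total 0 x with hx | hx
  · rw [abs_of_nonneg hx, abs_le]
    constructor <;> nlinarith
  · rw [abs_of_nonpos hx, abs_le]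
    constructor <;> nlinarith

theorem ofReal_mul_eLpNorm_one_withDensity_inv_mul_exp {U : Type*} [MeasurableSpace U]
    {μ : Measure U} {Φ f : U → ℝ} (hΦ : Measurable Φ) (hf : Measurable f)
    {Z : ℝ} (hZ : 0 < Z) :
    ENNReal.ofReal Z *
        eLpNorm f 1 (μ.withDensity fun u => ENNReal.ofReal (Z⁻¹ * Real.exp (-Φ u))) =
      ∫⁻ u, ‖Real.exp (-Φ u) * f u‖ₑ ∂μ := by
  rw [eLpNorm_one_eq_lintegral_enorm,
    lintegral_withDensity_eq_lintegral_mul _ (by fun_prop) (by fun_prop),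
    ← lintegral_const_mul _ (by fun_prop)]
  refine lintegral_congr fun u => ?_
  rw [Pi.mul_apply, ← mul_assoc, ← ENNReal.ofReal_mul hZ.le, mul_inv_cancel_left₀ hZ.ne',
    enorm_mul, Real.enorm_of_nonneg (Real.exp_pos _).le]

theorem eLpNorm_one_sub_exp_le {U : Type*} [MeasurableSpace U] {ν : Measure U}
    [IsProbabilityMeasure ν] {D : U → ℝ} (hD : Measurable D) {p q : ℝ≥0∞}
    (hpq : 1 / p + 1 / q = 1) {C : ℝ≥0∞}
    (hC : eLpNorm (fun u => Real.exp (D u)) p ν ≤ C) :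
    eLpNorm (fun u => 1 - Real.exp (D u)) 1 ν ≤ (1 + C) * eLpNorm D (2 * q) ν := by
  have : HolderTriple p q 1 := ⟨by simpa using hpq⟩
  have hq : 1 ≤ q := by
    rw [← ENNReal.inv_le_one, ← one_div]
    exact (self_le_add_left (1 / q) (1 / p)).trans hpq.le
  have hq2 : q ≤ 2 * q := le_mul_of_one_le_left' one_le_two
  have h1 : eLpNorm (fun u => |D u|) 1 ν ≤ eLpNorm D (2 * q) ν := by
    rw [show (fun u => |D u|) = fun u => ‖D u‖ from rfl, eLpNorm_norm]
    exact eLpNorm_le_eLpNorm_of_exponent_le (hq.trans hq2) hD.aestronglyMeasurable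
  have h2 : eLpNorm (fun u => |D u| * Real.exp (D u)) 1 ν ≤ C * eLpNorm D (2 * q) ν := by
    calc eLpNorm (fun u => |D u| * Real.exp (D u)) 1 ν
        = eLpNorm ((fun u => Real.exp (D u)) • D) 1 ν := by
          refine eLpNorm_congr_norm_ae (.of_forall fun u => ?_)
          simp [mul_comm]
      _ ≤ eLpNorm (fun u => Real.exp (D u)) p ν * eLpNorm D q ν :=
          eLpNorm_smul_le_mul_eLpNorm hD.aestronglyMeasurable
            (by fun_prop : Measurable fun u => Real.exp (D u)).aestronglyMeasurable
      _ ≤ C * eLpNorm D (2 * q) ν :=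
          mul_le_mul' hC (eLpNorm_le_eLpNorm_of_exponent_le hq2 hD.aestronglyMeasurable)
  calc eLpNorm (fun u => 1 - Real.exp (D u)) 1 ν
      ≤ eLpNorm ((fun u => |D u|) + fun u => |D u| * Real.exp (D u)) 1 ν :=
        eLpNorm_mono_real fun u => abs_one_sub_exp_le (D u)
    _ ≤ eLpNorm (fun u => |D u|) 1 ν + eLpNorm (fun u => |D u| * Real.exp (D u)) 1 ν :=
        eLpNorm_add_le (by fun_prop : Measurable fun u => |D u|).aestronglyMeasurable
          (by fun_prop : Measurable fun u => |D u| * Real.exp (D u)).aestronglyMeasurable le_rfl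
    _ ≤ (1 + C) * eLpNorm D (2 * q) ν := by
        rw [add_mul, one_mul]
        exact add_le_add h1 h2

/-- Bound on the difference of normalization constants for the mean-based approximation:
`Z_Ψ` is finite and `|Z − Z_Ψ| ≤ Z·(1 + C₁)·‖Φ − Ψ‖_{L^{2p₁'}_{μ^y}}`. -/
theorem stmt_14 {U : Type*} [MeasurableSpace U] (μ₀ : Measure U) [IsProbabilityMeasure μ₀]
    (Φ : U → ℝ) (hΦ : Measurable Φ)
    (Z : ℝ) (hZ : Z = ∫ u, Real.exp (-Φ u) ∂μ₀) (hZpos : 0 < Z)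
    (p₁ p₁' : ℝ≥0∞) (hp₁ : 1 < p₁) (hconj : 1 / p₁ + 1 / p₁' = 1)
    (C₁ : ℝ) (hC₁ : 0 < C₁)
    (Ψ : U → ℝ) (hΨ : Measurable Ψ)
    (hbound : eLpNorm (fun u => Real.exp (Φ u - Ψ u)) p₁
        (μ₀.withDensity fun u => ENNReal.ofReal (Z⁻¹ * Real.exp (-Φ u)))
      ≤ ENNReal.ofReal C₁) :
    Integrable (fun u => Real.exp (-Ψ u)) μ₀ ∧
    ENNReal.ofReal |Z - ∫ u, Real.exp (-Ψ u) ∂μ₀| ≤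
      ENNReal.ofReal (Z * (1 + C₁)) *
        eLpNorm (fun u => Φ u - Ψ u) (2 * p₁')
          (μ₀.withDensity fun u => ENNReal.ofReal (Z⁻¹ * Real.exp (-Φ u))) := by
  set ν := μ₀.withDensity fun u => ENNReal.ofReal (Z⁻¹ * Real.exp (-Φ u)) with hν
  have hint : Integrable (fun u => Real.exp (-Φ u)) μ₀ := by
    by_contra h
    rw [integral_undef h] at hZ
    exact hZpos.ne' hZ
  have hprob : IsProbabilityMeasure ν := by
    constructor
    rw [hν, withDensity_apply _ MeasurableSet.univ, setLIntegral_univ,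
      ← ofReal_integral_eq_lintegral_ofReal (hint.const_mul _)
        (.of_forall fun u => by positivity),
      integral_const_mul, ← hZ, inv_mul_cancel₀ hZpos.ne', ENNReal.ofReal_one]
  have hmeas : Measurable fun u => Real.exp (Φ u - Ψ u) := by fun_prop
  have hmul (u : U) : Real.exp (-Φ u) * Real.exp (Φ u - Ψ u) = Real.exp (-Ψ u) := by
    rw [← Real.exp_add]
    ring_nf
  have hintΨ : Integrable (fun u => Real.exp (-Ψ u)) μ₀ := by
    refine ⟨(by fun_prop : Measurable fun u => Real.exp (-Ψ u)).aestronglyMeasurable, ?_⟩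
    have h := ofReal_mul_eLpNorm_one_withDensity_inv_mul_exp (μ := μ₀) hΦ hmeas hZpos
    simp only [hmul] at h
    rw [hasFiniteIntegral_iff_enorm, ← h]
    exact ENNReal.mul_lt_top ENNReal.ofReal_lt_top
      (((eLpNorm_le_eLpNorm_of_exponent_le hp₁.le hmeas.aestronglyMeasurable).trans
        hbound).trans_lt ENNReal.ofReal_lt_top)
  refine ⟨hintΨ, ?_⟩
  calc ENNReal.ofReal |Z - ∫ u, Real.exp (-Ψ u) ∂μ₀|
      = ‖∫ u, (Real.exp (-Φ u) - Real.exp (-Ψ u)) ∂μ₀‖ₑ := by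
        rw [integral_sub hint hintΨ, ← hZ, Real.enorm_eq_ofReal_abs]
    _ ≤ ∫⁻ u, ‖Real.exp (-Φ u) - Real.exp (-Ψ u)‖ₑ ∂μ₀ := enorm_integral_le_lintegral_enorm _
    _ = ENNReal.ofReal Z * eLpNorm (fun u => 1 - Real.exp (Φ u - Ψ u)) 1 ν := by
        rw [hν, ofReal_mul_eLpNorm_one_withDensity_inv_mul_exp hΦ (by fun_prop) hZpos]
        simp only [mul_sub, mul_one, hmul]
    _ ≤ ENNReal.ofReal Z *
          ((1 + ENNReal.ofReal C₁) * eLpNorm (fun u => Φ u - Ψ u) (2 * p₁') ν) := by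
        gcongr
        exact eLpNorm_one_sub_exp_le (hΦ.sub hΨ) hconj hbound
    _ = ENNReal.ofReal (Z * (1 + C₁)) * eLpNorm (fun u => Φ u - Ψ u) (2 * p₁') ν := by
        rw [← mul_assoc, ENNReal.ofReal_mul hZpos.le,
          ENNReal.ofReal_add zero_le_one hC₁.le, ENNReal.ofReal_one]
end
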